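/- arXiv:0709.4316 — 4 statements merged into one kernel-verified Lean document; each statement's English description precedes it below -/
import Mathlib

section
/- Fix w > 0, θ ∈ ℝ and c > 0. Then the set B(c,θ) = {x ∈ ℝ : (w + φ(x))/φ(x−θ) − c < 0} is either the empty set or a bounded open interval; that is, there exist real numbers a ≤ b such that B(c,θ) equals the open interval (a, b) (with B(c,θ) empty when a = b). -/
open Real Set

/-- The standard normal density. -/
noncomputable def phi (x : ℝ) : ℝ := (Real.sqrt (2 * Real.pi))⁻¹ * Real.exp (-x ^ 2 / 2)

/-- `g(x, c, θ)` for a given weight `w`. -/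
noncomputable def g (w x c θ : ℝ) : ℝ := (w + phi x) / phi (x - θ) - c

/-- The set `B(c, θ) = {x : g(x, c, θ) < 0}` for a given weight `w`. -/
def B (w c θ : ℝ) : Set ℝ := {x : ℝ | g w x c θ < 0}

theorem ConvexOn.real_exp_comp {s : Set ℝ} {f : ℝ → ℝ} (hf : ConvexOn ℝ s f) :
    ConvexOn ℝ s fun x => Real.exp (f x) :=
  ⟨hf.1, fun _ hx _ hy _ _ ha hb hab =>
    (Real.exp_le_exp.2 (hf.2 hx hy ha hb hab)).trans
      (convexOn_exp.2 (mem_univ _) (mem_univ _) ha hb hab)⟩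

theorem exists_eq_Ioo_of_isOpen_of_convex {s : Set ℝ} (ho : IsOpen s) (hc : Convex ℝ s)
    (hb : Bornology.IsBounded s) : ∃ a b : ℝ, a ≤ b ∧ s = Ioo a b := by
  rcases s.eq_empty_or_nonempty with rfl | hne
  · exact ⟨0, 0, le_rfl, by simp⟩
  · refine ⟨sInf s, sSup s, csInf_le_csSup hne hb.bddBelow hb.bddAbove, ?_⟩
    apply Subset.antisymm
    · rw [← interior_Icc]
      exact interior_maximal (subset_Icc_csInf_csSup hb.bddBelow hb.bddAbove) ho
    · exact IsConnected.Ioo_csInf_csSup_subset ⟨hne, hc.isPreconnected⟩ hb.bddBelow hb.bddAbove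

theorem g_eq (w x c θ : ℝ) :
    g w x c θ = w * √(2 * π) * Real.exp ((x - θ) ^ 2 / 2) +
      Real.exp (θ ^ 2 / 2 - θ * x) - c := by
  have h : Real.exp (-x ^ 2 / 2) =
      Real.exp (θ ^ 2 / 2 - θ * x) * Real.exp (-(x - θ) ^ 2 / 2) := by
    rw [← Real.exp_add]; congr 1; ring
  have h' : Real.exp ((x - θ) ^ 2 / 2) = (Real.exp (-(x - θ) ^ 2 / 2))⁻¹ := by
    rw [← Real.exp_neg]; congr 1; ring
  have hpi : √(2 * π) ≠ 0 := by positivity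
  have he := (Real.exp_pos (-(x - θ) ^ 2 / 2)).ne'
  unfold g phi
  rw [h, h']
  field_simp

theorem continuous_g (w c θ : ℝ) : Continuous fun x => g w x c θ := by
  simp only [g_eq]
  fun_prop

theorem convexOn_g {w : ℝ} (hw : 0 ≤ w) (c θ : ℝ) :
    ConvexOn ℝ univ fun x => g w x c θ := by
  simp only [g_eq]
  have h₁ : ConvexOn ℝ univ fun x : ℝ => (x - θ) ^ 2 / 2 := by
    refine ⟨convex_univ, fun x _ y _ a b ha hb hab => ?_⟩
    obtain rfl : b = 1 - a := by linarith
    simp only [smul_eq_mul]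
    nlinarith [mul_nonneg (mul_nonneg ha hb) (sq_nonneg (x - y))]
  have h₂ : ConvexOn ℝ univ fun x : ℝ => θ ^ 2 / 2 - θ * x := by
    refine ⟨convex_univ, fun x _ y _ a b _ _ hab => le_of_eq ?_⟩
    obtain rfl : b = 1 - a := by linarith
    simp only [smul_eq_mul]
    ring
  have hk : 0 ≤ w * √(2 * π) := by positivity
  exact ((h₁.real_exp_comp.smul hk).add h₂.real_exp_comp).sub (concaveOn_const c convex_univ)

theorem isBounded_B {w : ℝ} (hw : 0 < w) (c θ : ℝ) : Bornology.IsBounded (B w c θ) := by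
  have hk : 0 < w * √(2 * π) := by positivity
  refine Metric.isBounded_closedBall.subset
    (?_ : B w c θ ⊆ Metric.closedBall θ (c / (w * √(2 * π))))
  intro x hx
  have hx' : g w x c θ < 0 := hx
  rw [g_eq] at hx'
  have h₁ : Real.exp ((x - θ) ^ 2 / 2) < c / (w * √(2 * π)) := by
    rw [lt_div_iff₀ hk]
    linarith [Real.exp_pos (θ ^ 2 / 2 - θ * x)]
  rw [Metric.mem_closedBall, Real.dist_eq]
  nlinarith [Real.add_one_le_exp ((x - θ) ^ 2 / 2), sq_abs (x - θ), sq_nonneg (|x - θ| - 1)]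

/-- for fixed `w > 0`, `θ ∈ ℝ` and `c > 0`, the set `B(c, θ)` is either empty
or a bounded open interval: there are `a ≤ b` with `B(c, θ) = (a, b)`
(the set being empty when `a = b`). -/
theorem stmt_0 (w θ c : ℝ) (hw : 0 < w) (hc : 0 < c) :
    ∃ a b : ℝ, a ≤ b ∧ B w c θ = Set.Ioo a b := by
  have hB : B w c θ = {x ∈ univ | g w x c θ < 0} := by simp [B]
  exact exists_eq_Ioo_of_isOpen_of_convex (isOpen_lt (continuous_g w c θ) continuous_const)
    (hB ▸ (convexOn_g hw.le c θ).convex_lt 0) (isBounded_B hw c θ)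
end

section
/- Let 0 < α < 1, w > 0 and θ ∈ ℝ. If c > 0 is such that the N(θ,1) probability of the set B(c,θ) equals 1 − α, then w√(2π) · exp(z²_{α/2}/2) ≤ c ≤ (w√(2π) + 1) · exp(z²_{α/2}/2). -/
open Real Set MeasureTheory ProbabilityTheory

/-- The standard normal cumulative distribution function. -/
noncomputable def Phi (x : ℝ) : ℝ := ∫ t in Set.Iic x, phi t

lemma phi_eq_gaussianPDFReal : phi = gaussianPDFReal 0 1 := by
  funext x
  simp [phi, gaussianPDFReal]

lemma integrable_phi : Integrable phi := by
  rw [phi_eq_gaussianPDFReal]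
  exact integrable_gaussianPDFReal 0 1

lemma phi_pos (x : ℝ) : 0 < phi x := by
  unfold phi
  positivity

lemma integral_phi : ∫ t, phi t = 1 := by
  rw [phi_eq_gaussianPDFReal]
  exact integral_gaussianPDFReal_eq_one 0 one_ne_zero

lemma Phi_sub_Phi (a b : ℝ) : Phi b - Phi a = ∫ t in a..b, phi t :=
  intervalIntegral.integral_Iic_sub_Iic integrable_phi.integrableOn integrable_phi.integrableOn

lemma Phi_strictMono : StrictMono Phi := fun a b hab => by
  rw [← sub_pos, Phi_sub_Phi]
  exact intervalIntegral.intervalIntegral_pos_of_pos integrable_phi.intervalIntegrable phi_pos hab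

lemma Phi_neg (x : ℝ) : Phi (-x) = 1 - Phi x := by
  have h : Phi (-x) = ∫ t in Ioi x, phi t := by
    have h := integral_comp_neg_Ioi x phi
    rw [Phi, ← h]
    simp [phi]
  have h' := intervalIntegral.integral_Iic_add_Ioi (b := x) (f := phi) (μ := volume)
    integrable_phi.integrableOn integrable_phi.integrableOn
  rw [integral_phi] at h'
  rw [h, Phi]
  linarith

lemma gaussianReal_Ioo (θ : ℝ) {r : ℝ} (hr : 0 ≤ r) :
    gaussianReal θ 1 (Ioo (θ - r) (θ + r)) = ENNReal.ofReal (2 * Phi r - 1) := by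
  have hmap : gaussianReal θ 1 = (gaussianReal 0 1).map (· + θ) := by
    rw [gaussianReal_map_add_const, zero_add]
  have hpre : (· + θ) ⁻¹' Ioo (θ - r) (θ + r) = Ioo (-r) r := by
    ext x
    simp only [mem_preimage, mem_Ioo]
    constructor <;> rintro ⟨h₁, h₂⟩ <;> constructor <;> linarith
  rw [hmap, Measure.map_apply (by fun_prop) measurableSet_Ioo, hpre,
    gaussianReal_apply_eq_integral _ one_ne_zero, ← phi_eq_gaussianPDFReal,
    ← integral_Ioc_eq_integral_Ioo, ← intervalIntegral.integral_of_le (by linarith),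
    ← Phi_sub_Phi, Phi_neg]
  congr 1
  ring

lemma Phi_zero : Phi 0 = 1 / 2 := by
  have h := Phi_neg 0
  rw [neg_zero] at h
  linarith

/-- The superlevel set of a Gaussian bump is an interval. -/
lemma mem_Ioo_sqrt_log_iff {K c : ℝ} (hK : 0 < K) (hc : 0 < c) (θ x : ℝ) :
    x ∈ Ioo (θ - √(2 * log (c / K))) (θ + √(2 * log (c / K))) ↔
      K < c * exp (-(x - θ) ^ 2 / 2) := by
  have h₁ : x ∈ Ioo (θ - √(2 * log (c / K))) (θ + √(2 * log (c / K))) ↔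
      |x - θ| < √(2 * log (c / K)) := by
    rw [abs_lt, mem_Ioo]
    constructor <;> rintro ⟨h₁, h₂⟩ <;> constructor <;> linarith
  have h₂ : K < c * exp (-(x - θ) ^ 2 / 2) ↔ exp ((x - θ) ^ 2 / 2) < c / K := by
    rw [neg_div, exp_neg, lt_div_iff₀ hK, ← div_eq_mul_inv, lt_div_iff₀ (exp_pos _), mul_comm]
  rw [h₁, h₂, Real.lt_sqrt (abs_nonneg _), sq_abs, ← Real.lt_log_iff_exp_lt (div_pos hc hK),
    div_lt_iff₀' two_pos]

lemma mem_B_iff (w x c θ : ℝ) :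
    x ∈ B w c θ ↔ w * √(2 * π) + exp (-x ^ 2 / 2) < c * exp (-(x - θ) ^ 2 / 2) := by
  have hs : 0 < √(2 * π) := by positivity
  have h₁ : √(2 * π) * (w + phi x) = w * √(2 * π) + exp (-x ^ 2 / 2) := by
    rw [phi]
    field_simp
  have h₂ : √(2 * π) * (c * phi (x - θ)) = c * exp (-(x - θ) ^ 2 / 2) := by
    rw [phi]
    field_simp
  rw [← h₁, ← h₂, mul_lt_mul_iff_right₀ hs, B, mem_ofPred_eq, g, sub_neg,
    div_lt_iff₀ (phi_pos _)]

/-- let `0 < α < 1`, `w > 0` and `θ ∈ ℝ`. If `c > 0` is such that the `N(θ,1)`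
probability of `B(c, θ)` equals `1 − α`, then
`w √(2π) exp(z²_{α/2}/2) ≤ c ≤ (w √(2π) + 1) exp(z²_{α/2}/2)`,
where `z_{α/2}` is the upper-`α/2` quantile of `N(0,1)`, i.e. `Φ(z_{α/2}) = 1 − α/2`. -/
theorem stmt_3 (α w θ c z : ℝ) (hα : 0 < α) (hα1 : α < 1) (hw : 0 < w) (hc : 0 < c)
    (hz : Phi z = 1 - α / 2)
    (hcov : gaussianReal θ 1 (B w c θ) = ENNReal.ofReal (1 - α)) :
    w * Real.sqrt (2 * Real.pi) * Real.exp (z ^ 2 / 2) ≤ c ∧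
      c ≤ (w * Real.sqrt (2 * Real.pi) + 1) * Real.exp (z ^ 2 / 2) := by
  have hz0 : 0 < z := by
    rw [← Phi_strictMono.lt_iff_lt, Phi_zero, hz]
    linarith
  have hα' : 1 - α = 2 * Phi z - 1 := by linarith
  have hP : 0 < 2 * Phi z - 1 := by linarith
  have hK : 0 < w * √(2 * π) := by positivity
  have hK' : 0 < w * √(2 * π) + 1 := by positivity
  rw [hα'] at hcov
  constructor
  · have hsub : B w c θ ⊆ Ioo (θ - √(2 * log (c / (w * √(2 * π)))))
        (θ + √(2 * log (c / (w * √(2 * π))))) := fun x hx => by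
      rw [mem_B_iff] at hx
      rw [mem_Ioo_sqrt_log_iff hK hc]
      linarith [exp_pos (-x ^ 2 / 2)]
    have hle := measure_mono (μ := gaussianReal θ 1) hsub
    have hr := Real.sqrt_nonneg (2 * log (c / (w * √(2 * π))))
    have hmono := Phi_strictMono.monotone hr
    rw [Phi_zero] at hmono
    rw [hcov, gaussianReal_Ioo θ hr, ENNReal.ofReal_le_ofReal_iff (by linarith)] at hle
    have hzr := Phi_strictMono.le_iff_le.1 (by linarith : Phi z ≤ Phi _)
    rw [Real.le_sqrt' hz0, ← div_le_iff₀' two_pos, Real.le_log_iff_exp_le (div_pos hc hK),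
      le_div_iff₀' hK] at hzr
    exact hzr
  · have hsub : Ioo (θ - √(2 * log (c / (w * √(2 * π) + 1))))
        (θ + √(2 * log (c / (w * √(2 * π) + 1)))) ⊆ B w c θ := fun x hx => by
      rw [mem_Ioo_sqrt_log_iff hK' hc] at hx
      rw [mem_B_iff]
      have : exp (-x ^ 2 / 2) ≤ 1 := Real.exp_le_one_iff.2 (by nlinarith [sq_nonneg x])
      linarith
    have hle := measure_mono (μ := gaussianReal θ 1) hsub
    rw [hcov, gaussianReal_Ioo θ (Real.sqrt_nonneg _), ENNReal.ofReal_le_ofReal_iff hP.le] at hle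
    have hzr := Phi_strictMono.le_iff_le.1 (by linarith : Phi _ ≤ Phi z)
    rw [Real.sqrt_le_left hz0.le, ← le_div_iff₀' two_pos, Real.log_le_iff_le_exp (div_pos hc hK'),
      div_le_iff₀' hK'] at hzr
    exact hzr
end

section
/- Let 0 < α < 1/2 and let X ~ N(θ,1). For Pratt's confidence interval [min(0, X − z_α), max(0, X + z_α)], the coverage probability P_θ(min(0, X − z_α) ≤ θ ≤ max(0, X + z_α)) equals exactly 1 − α for every θ ≠ 0, and equals 1 when θ = 0. In particular the coverage probability is at least 1 − α for all θ ∈ ℝ. -/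
open Real Set MeasureTheory ProbabilityTheory

theorem gaussianReal_zero_one_Iic (z : ℝ) :
    gaussianReal 0 1 (Set.Iic z) = ENNReal.ofReal (Phi z) := by
  rw [gaussianReal_apply_eq_integral 0 one_ne_zero, Phi]
  simp [gaussianPDFReal, phi]

theorem gaussianReal_Iic_add (θ z : ℝ) :
    gaussianReal θ 1 (Set.Iic (θ + z)) = ENNReal.ofReal (Phi z) := by
  have h := gaussianReal_map_const_add (μ := 0) (v := 1) θ
  rw [zero_add] at h
  rw [← h, Measure.map_apply (by fun_prop) measurableSet_Iic, ← gaussianReal_zero_one_Iic]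
  congr 1
  ext x
  simp

theorem gaussianReal_Ici_sub (θ z : ℝ) :
    gaussianReal θ 1 (Set.Ici (θ - z)) = ENNReal.ofReal (Phi z) := by
  have h := gaussianReal_map_const_sub (μ := 0) (v := 1) θ
  rw [sub_zero] at h
  rw [← h, Measure.map_apply (by fun_prop) measurableSet_Ici, ← gaussianReal_zero_one_Iic]
  congr 1
  ext x
  simp

/-- let `0 < α < 1/2` and `z = z_α` be the upper-`α` quantile of `N(0,1)`
(`Φ(z_α) = 1 − α`).  For Pratt's interval `[min(0, X − z_α), max(0, X + z_α)]` with
`X ∼ N(θ,1)`, the coverage probability equals exactly `1 − α` for every `θ ≠ 0`, equals `1`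
when `θ = 0`, and in particular is at least `1 − α` for all `θ`. -/
theorem stmt_8 (α z : ℝ) (hα : 0 < α) (hα2 : α < 1 / 2) (hz : Phi z = 1 - α) :
    (∀ θ : ℝ, θ ≠ 0 →
      gaussianReal θ 1 {x : ℝ | min 0 (x - z) ≤ θ ∧ θ ≤ max 0 (x + z)} =
        ENNReal.ofReal (1 - α)) ∧
    gaussianReal 0 1 {x : ℝ | min 0 (x - z) ≤ 0 ∧ (0 : ℝ) ≤ max 0 (x + z)} = 1 ∧
    ∀ θ : ℝ,
      ENNReal.ofReal (1 - α) ≤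
        gaussianReal θ 1 {x : ℝ | min 0 (x - z) ≤ θ ∧ θ ≤ max 0 (x + z)} := by
  have exact_coverage : ∀ θ : ℝ, θ ≠ 0 →
      gaussianReal θ 1 {x : ℝ | min 0 (x - z) ≤ θ ∧ θ ≤ max 0 (x + z)} =
        ENNReal.ofReal (1 - α) := by
    intro θ hθ
    rw [← hz]
    rcases hθ.lt_or_gt with h | h
    · rw [← gaussianReal_Iic_add θ z]
      congr 1
      ext x
      simp [h.le, h.not_ge]
    · rw [← gaussianReal_Ici_sub θ z]
      congr 1
      ext x
      simp [h.le, h.not_ge]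
  have coverage_zero :
      gaussianReal 0 1 {x : ℝ | min 0 (x - z) ≤ 0 ∧ (0 : ℝ) ≤ max 0 (x + z)} = 1 := by
    simp
  refine ⟨exact_coverage, coverage_zero, fun θ => ?_⟩
  rcases eq_or_ne θ 0 with rfl | hθ
  · rw [coverage_zero, ENNReal.ofReal_le_one]
    linarith
  · exact (exact_coverage θ hθ).ge
end

section
/- Let 0 < α < 1/2 and let X ~ N(θ,1). The expected length of Pratt's confidence interval, E_θ[max(0, X + z_α) − min(0, X − z_α)], tends to +∞ as |θ| → ∞ (i.e. it tends to +∞ both as θ → +∞ and as θ → −∞). -/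
open Real Set MeasureTheory ProbabilityTheory Filter

theorem integrable_id_gaussianReal_one (θ : ℝ) :
    Integrable (fun x : ℝ => x) (gaussianReal θ 1) :=
  (memLp_id_gaussianReal (μ := θ) (v := 1) 1).integrable (by simp)

theorem integrable_pratt_length (θ z : ℝ) :
    Integrable (fun x : ℝ => max 0 (x + z) - min 0 (x - z)) (gaussianReal θ 1) := by
  have hid := integrable_id_gaussianReal_one θ
  exact ((integrable_const 0).sup (hid.add (integrable_const z))).sub
    ((integrable_const 0).inf (hid.sub (integrable_const z)))

theorem add_le_expected_pratt_length (θ z : ℝ) :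
    θ + z ≤ ∫ x, (max 0 (x + z) - min 0 (x - z)) ∂(gaussianReal θ 1) := by
  have hid := integrable_id_gaussianReal_one θ
  calc θ + z = ∫ x, (x + z) ∂(gaussianReal θ 1) := by
        rw [integral_add hid (integrable_const z), integral_id_gaussianReal]
        simp
    _ ≤ _ := integral_mono (hid.add (integrable_const z)) (integrable_pratt_length θ z)
        fun x => by
          have h₁ := le_max_right 0 (x + z)
          have h₂ := min_le_left 0 (x - z)
          dsimp only
          linarith

theorem sub_le_expected_pratt_length (θ z : ℝ) :
    z - θ ≤ ∫ x, (max 0 (x + z) - min 0 (x - z)) ∂(gaussianReal θ 1) := by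
  have hid := integrable_id_gaussianReal_one θ
  calc z - θ = ∫ x, (z - x) ∂(gaussianReal θ 1) := by
        rw [integral_sub (integrable_const z) hid, integral_id_gaussianReal]
        simp
    _ ≤ _ := integral_mono ((integrable_const z).sub hid) (integrable_pratt_length θ z)
        fun x => by
          have h₁ := le_max_left 0 (x + z)
          have h₂ := min_le_right 0 (x - z)
          dsimp only
          linarith

/-- let `0 < α < 1/2` and `z = z_α` be the upper-`α` quantile of `N(0,1)`
(`Φ(z_α) = 1 − α`).  The expected length of Pratt's interval,
`E_θ[max(0, X + z_α) − min(0, X − z_α)]` for `X ∼ N(θ,1)`, tends to `+∞` as `|θ| → ∞`,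
i.e. both as `θ → +∞` and as `θ → −∞`. -/
theorem stmt_9 (α z : ℝ) (hα : 0 < α) (hα2 : α < 1 / 2) (hz : Phi z = 1 - α) :
    Tendsto (fun θ : ℝ => ∫ x, (max 0 (x + z) - min 0 (x - z)) ∂(gaussianReal θ 1))
        atTop atTop ∧
      Tendsto (fun θ : ℝ => ∫ x, (max 0 (x + z) - min 0 (x - z)) ∂(gaussianReal θ 1))
        atBot atTop := by
  exact ⟨tendsto_atTop_mono (fun θ => add_le_expected_pratt_length θ z)
      (tendsto_atTop_add_const_right _ z tendsto_id),
    tendsto_atTop_mono (fun θ => sub_le_expected_pratt_length θ z)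
      (tendsto_atTop_add_const_left _ z tendsto_neg_atBot_atTop)⟩
end
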